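/- Let G and H be reflexive undirected graphs, α, β : G → H homomorphisms, and q ∈ V(G). Let \bar Π be the set of all walks that are H-realizable for α, β, q (via H-recoloring sequences satisfying the push-or-pull property). Then one of the following holds: (1) \bar Π = ∅; (2) \bar Π = {Q} for some Q ∈ π(H); (3) \bar Π = {RⁿP : n ∈ ℤ} for some R, P ∈ π(H) with R a closed walk at α(q); (4) \bar Π contains all reduced walks from α(q) to β(q). Moreover, case (4) holds whenever α(C) = β(C) = ε in π(H) for every closed walk C in G. -/

import Mathlib

namespace HRecoloring

/-- A digraph: a vertex type together with an arc relation. -/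
structure Dgraph (V : Type) where
  Adj : V → V → Prop

variable {V X : Type}

/-- Adjacency in the underlying undirected graph. -/
def Dgraph.UAdj (G : Dgraph V) (u v : V) : Prop := G.Adj u v ∨ G.Adj v u

/-- A digraph is loopless if it has no arc `v → v`. -/
def Dgraph.Loopless (G : Dgraph V) : Prop := ∀ v, ¬ G.Adj v v

/-- A digraph is reflexive if `v → v` for every vertex `v`. -/
def Dgraph.IsReflexive (G : Dgraph V) : Prop := ∀ v, G.Adj v v

/-- A symmetric digraph, which we identify with an undirected graph. -/
def Dgraph.IsSymmetric (G : Dgraph V) : Prop := ∀ u v, G.Adj u v → G.Adj v u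

/-- The underlying undirected graph, as a symmetric digraph. -/
def Dgraph.usym (G : Dgraph V) : Dgraph V := ⟨fun u v => G.UAdj u v⟩

/-- A (di)graph homomorphism. -/
def IsHom (G : Dgraph V) (H : Dgraph X) (f : V → X) : Prop :=
  ∀ ⦃u v⦄, G.Adj u v → H.Adj (f u) (f v)

/-- A walk from `a` to `b`, encoded by its list of successive vertices.
A walk in a digraph is a walk in its underlying undirected graph. -/
def IsWalk (G : Dgraph V) (a b : V) (l : List V) : Prop :=
  l ≠ [] ∧ l.head? = some a ∧ l.getLast? = some b ∧ l.Chain' G.UAdj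

/-- Weak connectivity. -/
def Dgraph.WConn (G : Dgraph V) : Prop := ∀ u v : V, ∃ l, IsWalk G u v l

/-- Concatenation of two walks sharing an endpoint. -/
def wcomp (l₁ l₂ : List V) : List V := l₁ ++ l₂.tail

/-- Number of edges of a walk. -/
def wlen (l : List V) : ℕ := l.length - 1

/-- One reduction step on walks: delete a backtracking pair `(x y)(y x)` or a
one-edge loop step `(x x)`. -/
def RStep (l l' : List V) : Prop :=
  (∃ (p s : List V) (x y : V), l = p ++ [x, y, x] ++ s ∧ l' = p ++ [x] ++ s) ∨
  (∃ (p s : List V) (x : V), l = p ++ [x, x] ++ s ∧ l' = p ++ [x] ++ s)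

/-- Equality of walks in the fundamental groupoid `π(H)`: the equivalence
generated by reduction steps (two walks are equal in `π(H)` iff they reduce to
the same reduced walk). -/
def PiEq (l l' : List V) : Prop := Relation.EqvGen RStep l l'

/-- A walk is reduced if no reduction step applies to it. -/
def IsReduced (l : List V) : Prop := ∀ l', ¬ RStep l l'

/-- A closed walk is cyclically reduced if it is reduced and its first and last
edges are not inverses of each other. -/
def IsCycReduced (l : List V) : Prop :=
  IsReduced l ∧ ∃ h : 2 ≤ l.length,
    l.get ⟨1, by omega⟩ ≠ l.get ⟨l.length - 2, by omega⟩

/-- `n`-fold concatenation of a closed walk `R` based at `h`. -/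
def witer (R : List V) (h : V) : ℕ → List V
  | 0 => [h]
  | n + 1 => wcomp R (witer R h n)

/-- `Rⁿ` for an integer `n`, for a closed walk `R` based at `h`; for `n < 0`
this is the `|n|`-fold concatenation of the reversed walk `R⁻¹`. -/
def zpowWalk (R : List V) (h : V) (n : ℤ) : List V :=
  if 0 ≤ n then witer R h n.toNat else witer R.reverse h (-n).toNat

/-- A walk is symmetric if every edge it traverses is a symmetric arc. -/
def IsSymWalk (H : Dgraph X) (l : List X) : Prop :=
  l.Chain' fun a b => H.Adj a b ∧ H.Adj b a

/-- The conjugated walk `α(W)⁻¹ · Q · β(W)`. -/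
def conj (α β : V → X) (Wl : List V) (Q : List X) : List X :=
  wcomp (wcomp (Wl.map α).reverse Q) (Wl.map β)

/-- Topological validity of a walk `Q` from `α q` to `β q`:
`β(C) = Q⁻¹ · α(C) · Q` in `π(H)` for every closed walk `C` at `q`. -/
def TopValid (G : Dgraph V) (H : Dgraph X) (α β : V → X) (q : V) (Q : List X) : Prop :=
  ∀ C : List V, IsWalk G q q C →
    PiEq (C.map β) (wcomp (wcomp Q.reverse (C.map α)) Q)

/-- IN-zigzag pattern `a₁ ← a₂ → a₃ ← … ← a_{n-1} → a_n`. -/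
def INCompatible (H : Dgraph X) (l : List X) : Prop :=
  ∀ (i : ℕ) (h : i + 1 < l.length),
    if i % 2 = 0 then H.Adj (l.get ⟨i + 1, h⟩) (l.get ⟨i, by omega⟩)
    else H.Adj (l.get ⟨i, by omega⟩) (l.get ⟨i + 1, h⟩)

/-- OUT-zigzag pattern `a₁ → a₂ ← a₃ → … → a_{n-1} ← a_n`. -/
def OUTCompatible (H : Dgraph X) (l : List X) : Prop :=
  ∀ (i : ℕ) (h : i + 1 < l.length),
    if i % 2 = 0 then H.Adj (l.get ⟨i, by omega⟩) (l.get ⟨i + 1, h⟩)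
    else H.Adj (l.get ⟨i + 1, h⟩) (l.get ⟨i, by omega⟩)

/-- A vertex is of type IN if it has an in-neighbor. -/
def TypeIN (G : Dgraph V) (v : V) : Prop := ∃ u, G.Adj u v

/-- A vertex is of type OUT if it has an out-neighbor. -/
def TypeOUT (G : Dgraph V) (v : V) : Prop := ∃ u, G.Adj v u

/-- A vertex is of type SYM if it is of type IN and of type OUT. -/
def TypeSYM (G : Dgraph V) (v : V) : Prop := TypeIN G v ∧ TypeOUT G v

/-- The zigzag condition for the vertex `v`. -/
def Zigzag (G : Dgraph V) (H : Dgraph X) (v : V) (l : List X) : Prop :=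
  (TypeIN G v → INCompatible H l) ∧ (TypeOUT G v → OUTCompatible H l)

/-- A recoloring sequence: a nonempty sequence of homomorphisms in which
consecutive homomorphisms differ on exactly one vertex. -/
def IsRecolSeq (G : Dgraph V) (H : Dgraph X) (σs : List (V → X)) : Prop :=
  σs ≠ [] ∧ (∀ σ ∈ σs, IsHom G H σ) ∧ σs.Chain' fun σ σ' => ∃! u, σ u ≠ σ' u

/-- The monochromatic neighborhood property: whenever a vertex changes its
color, all of its neighbors (in the underlying undirected graph) have one
common color. -/
def MonoNbhd (G : Dgraph V) (σs : List (V → X)) : Prop :=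
  σs.Chain' fun σ σ' => ∀ v, σ v ≠ σ' v → ∃ h, ∀ w, G.UAdj v w → σ w = h

/-- `VWalk G v σs S`: `S` is the vertex walk `S(v)` of the recoloring sequence
`σs`; each color change of `v` from `a` to `b`, while all neighbors of `v` are
colored `h`, contributes the two edges `(a h)(h b)`. -/
inductive VWalk (G : Dgraph V) (v : V) : List (V → X) → List X → Prop
  | single (σ : V → X) : VWalk G v [σ] [σ v]
  | stay {σ σ' : V → X} {rest : List (V → X)} {l : List X} :
      σ v = σ' v → VWalk G v (σ' :: rest) l → VWalk G v (σ :: σ' :: rest) l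
  | move {σ σ' : V → X} {rest : List (V → X)} {l : List X} (h : X) :
      σ v ≠ σ' v → (∀ w, G.UAdj v w → σ w = h) →
      VWalk G v (σ' :: rest) l → VWalk G v (σ :: σ' :: rest) (σ v :: h :: l)

/-- `H`-realizability of a walk `Q` via recoloring sequences satisfying the
monochromatic neighborhood property: `Q = S(q)` in `π(H)`. -/
def MRealizable (G : Dgraph V) (H : Dgraph X) (α β : V → X) (q : V) (Q : List X) : Prop :=
  ∃ (σs : List (V → X)) (Sq : List X),
    IsRecolSeq G H σs ∧ σs.head? = some α ∧ σs.getLast? = some β ∧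
    MonoNbhd G σs ∧ VWalk G q σs Sq ∧ PiEq Sq Q

/-- Orientation compatibility of a walk `Q`: every generated vertex walk
satisfies the zigzag condition. -/
def OrientCompatible (G : Dgraph V) (H : Dgraph X) (α β : V → X) (q : V) (Q : List X) : Prop :=
  ∀ (v : V) (Wl : List V), IsWalk G q v Wl →
    ∀ S : List X, IsReduced S → PiEq (conj α β Wl Q) S → Zigzag G H v S

/-- Hom₁-adjacency: the homomorphisms differ on exactly one vertex and, for
every arc `x → y` of `G`, both `φ x → ψ y` and `ψ x → φ y` are arcs of `H`. -/
def Hom1Adj (G : Dgraph V) (H : Dgraph X) (φ ψ : V → X) : Prop :=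
  (∃! u, φ u ≠ ψ u) ∧ ∀ ⦃x y⦄, G.Adj x y → H.Adj (φ x) (ψ y) ∧ H.Adj (ψ x) (φ y)

/-- A recoloring sequence in the Hom₁ sense (digraphs). -/
def Hom1Seq (G : Dgraph V) (H : Dgraph X) (σs : List (V → X)) : Prop :=
  σs ≠ [] ∧ (∀ σ ∈ σs, IsHom G H σ) ∧ σs.Chain' (Hom1Adj G H)

/-- A recoloring sequence in which each step recolors exactly one vertex to an
adjacent color (the Hom₁ sense for reflexive undirected graphs). -/
def AdjRecolSeq (G : Dgraph V) (H : Dgraph X) (σs : List (V → X)) : Prop :=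
  σs ≠ [] ∧ (∀ σ ∈ σs, IsHom G H σ) ∧
  σs.Chain' fun σ σ' => (∃! u, σ u ≠ σ' u) ∧ ∀ u, σ u ≠ σ' u → H.Adj (σ u) (σ' u)

/-- The push-or-pull property: whenever a vertex changes its color from `a` to
`b`, every neighbor of that vertex has color `a` or `b`. -/
def PushOrPull (G : Dgraph V) (σs : List (V → X)) : Prop :=
  σs.Chain' fun σ σ' => ∀ u, σ u ≠ σ' u → ∀ w, G.UAdj u w → σ w = σ u ∨ σ w = σ' u

/-- The walk of successive colors of `v` along a recoloring sequence. -/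
def colorWalk (σs : List (V → X)) (v : V) : List X := σs.map fun σ => σ v

/-- `H`-realizability via recoloring sequences (reflexive undirected Hom₁
sense) satisfying the push-or-pull property. -/
def PRealizable (G : Dgraph V) (H : Dgraph X) (α β : V → X) (q : V) (Q : List X) : Prop :=
  ∃ σs : List (V → X), AdjRecolSeq G H σs ∧ σs.head? = some α ∧ σs.getLast? = some β ∧
    PushOrPull G σs ∧ PiEq (colorWalk σs q) Q

/-- `H`-realizability via Hom₁ recoloring sequences of digraphs satisfying the
push-or-pull property. -/
def DRealizable (G : Dgraph V) (H : Dgraph X) (α β : V → X) (q : V) (Q : List X) : Prop :=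
  ∃ σs : List (V → X), Hom1Seq G H σs ∧ σs.head? = some α ∧ σs.getLast? = some β ∧
    PushOrPull G σs ∧ PiEq (colorWalk σs q) Q

/-- `H` contains no 4-cycle of algebraic girth 0 as a subgraph (neither of the
two orientations of the 4-cycle with two forward and two backward arcs). -/
def NoZeroGirthC4 (H : Dgraph X) : Prop :=
  ∀ a b c d : X, a ≠ b → a ≠ c → a ≠ d → b ≠ c → b ≠ d → c ≠ d →
    ¬(H.Adj a b ∧ H.Adj b d ∧ H.Adj a c ∧ H.Adj c d) ∧
    ¬(H.Adj a b ∧ H.Adj d b ∧ H.Adj a c ∧ H.Adj d c)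

/-- `H` contains no triangle of algebraic girth 1 as a subgraph. -/
def NoOneGirthTriangle (H : Dgraph X) : Prop :=
  ∀ x y z : X, x ≠ y → y ≠ z → x ≠ z → ¬(H.Adj x y ∧ H.Adj y z ∧ H.Adj x z)

/-- A path in the reconfiguration graph `R_H(G)` from `α` to `β`. -/
def IsRPath (G : Dgraph V) (H : Dgraph X) (α β : V → X) (L : List (V → X)) : Prop :=
  L ≠ [] ∧ L.head? = some α ∧ L.getLast? = some β ∧
  (∀ σ ∈ L, IsHom G H σ) ∧ L.Chain' fun φ ψ => ∃! u, φ u ≠ ψ u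

/-- A path in the graph `Hom₁(G, H)` from `α` to `β`. -/
def IsHom1Path (G : Dgraph V) (H : Dgraph X) (α β : V → X) (L : List (V → X)) : Prop :=
  L ≠ [] ∧ L.head? = some α ∧ L.getLast? = some β ∧
  (∀ σ ∈ L, IsHom G H σ) ∧ L.Chain' (Hom1Adj G H)

/-- The set of reduced walks `Q` from `α q` to `β q` that generate symmetric
vertex walks on `V'` with the system of walks `Wf`. -/
def SymGenSet (H : Dgraph X) (α β : V → X) (q : V)
    (V' : Set V) (Wf : V → List V) : Set (List X) :=
  {Q | IsWalk H (α q) (β q) Q ∧ IsReduced Q ∧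
    ∀ v ∈ V', ∀ S : List X, IsReduced S → PiEq (conj α β (Wf v) Q) S → IsSymWalk H S}

/-- The set of orientation-compatible walks for `q` and the system `Uf`. -/
def OCSet (G : Dgraph V) (H : Dgraph X) (α β : V → X) (q : V)
    (Uf : V → List V) : Set (List X) :=
  {Q | IsWalk H (α q) (β q) Q ∧ IsReduced Q ∧ Even (wlen Q) ∧
    ∀ (v : V) (S : List X), IsReduced S → PiEq (conj α β (Uf v) Q) S → Zigzag G H v S}

/-- The set `Π_q` of walks from `α q` to `β q` that are `H`-realizable via
recoloring sequences satisfying the monochromatic neighborhood property. -/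
def MRealSet (G : Dgraph V) (H : Dgraph X) (α β : V → X) (q : V) : Set (List X) :=
  {Q | IsWalk H (α q) (β q) Q ∧ IsReduced Q ∧ MRealizable G H α β q Q}

/-- The set of walks from `α q` to `β q` that are `H`-realizable via
recoloring sequences satisfying the push-or-pull property. -/
def PRealSet (G : Dgraph V) (H : Dgraph X) (α β : V → X) (q : V) : Set (List X) :=
  {Q | IsWalk H (α q) (β q) Q ∧ IsReduced Q ∧ PRealizable G H α β q Q}

/-- Ceiling division on natural numbers. -/
def cdiv (a b : ℕ) : ℕ := (a + b - 1) / b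

end HRecoloring

open HRecoloring

namespace HRecoloring

/-! ### Walks as elements of a free group -/

section FreeGroupValue

variable {X : Type}

/-- The value of the edge `x y` in the free group on ordered pairs. It is trivial on loops, and
inverted when the edge is reversed. -/
def edgeVal (x y : X) : FreeGroup (X × X) := FreeGroup.of (x, y) * (FreeGroup.of (y, x))⁻¹

@[simp] lemma edgeVal_self (x : X) : edgeVal x x = 1 := by simp [edgeVal]

lemma edgeVal_inv (x y : X) : (edgeVal x y)⁻¹ = edgeVal y x := by simp [edgeVal]

@[simp] lemma edgeVal_mul_swap (x y : X) : edgeVal x y * edgeVal y x = 1 := by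
  rw [← edgeVal_inv y x, inv_mul_cancel]

@[simp] lemma edgeVal_mul_swap_mul (x y : X) (g : FreeGroup (X × X)) :
    edgeVal x y * (edgeVal y x * g) = g := by
  rw [← mul_assoc, edgeVal_mul_swap, one_mul]

/-- The product of the values of the edges of a walk. -/
def walkVal : List X → FreeGroup (X × X)
  | x :: y :: l => edgeVal x y * walkVal (y :: l)
  | _ => 1

@[simp] lemma walkVal_nil : walkVal ([] : List X) = 1 := rfl

@[simp] lemma walkVal_singleton (x : X) : walkVal [x] = 1 := rfl

@[simp] lemma walkVal_cons_cons (x y : X) (l : List X) :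
    walkVal (x :: y :: l) = edgeVal x y * walkVal (y :: l) := rfl

lemma walkVal_append_cons (p : List X) (x : X) (s : List X) :
    walkVal (p ++ x :: s) = walkVal (p ++ [x]) * walkVal (x :: s) := by
  induction p with
  | nil => simp
  | cons a p ih =>
    cases p with
    | nil => simp
    | cons b p => simpa [mul_assoc] using ih

lemma walkVal_concat_concat (p : List X) (x y : X) :
    walkVal (p ++ [x, y]) = walkVal (p ++ [x]) * edgeVal x y := by
  rw [walkVal_append_cons]; simp

lemma walkVal_reverse (l : List X) : walkVal l.reverse = (walkVal l)⁻¹ := by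
  induction l with
  | nil => simp
  | cons x l ih =>
    cases l with
    | nil => simp
    | cons y l =>
      have h := walkVal_concat_concat l.reverse y x
      simp only [List.reverse_cons, List.append_assoc, List.cons_append, List.nil_append,
        walkVal_cons_cons, mul_inv_rev, edgeVal_inv] at ih h ⊢
      rw [h, ih]

lemma RStep.walkVal_eq {l l' : List X} (h : RStep l l') : walkVal l = walkVal l' := by
  rcases h with ⟨p, s, x, y, rfl, rfl⟩ | ⟨p, s, x, rfl, rfl⟩ <;>
  · simp only [List.append_assoc, List.cons_append, List.nil_append]
    rw [walkVal_append_cons, walkVal_append_cons p x s]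
    simp

lemma RStep.head?_eq {l l' : List X} (h : RStep l l') : l.head? = l'.head? := by
  rcases h with ⟨p, s, x, y, rfl, rfl⟩ | ⟨p, s, x, rfl, rfl⟩ <;> cases p <;> simp

lemma RStep.length_lt {l l' : List X} (h : RStep l l') : l'.length < l.length := by
  rcases h with ⟨p, s, x, y, rfl, rfl⟩ | ⟨p, s, x, rfl, rfl⟩ <;> simp

lemma RStep.cons {l l' : List X} (h : RStep l l') (a : X) : RStep (a :: l) (a :: l') := by
  rcases h with ⟨p, s, x, y, rfl, rfl⟩ | ⟨p, s, x, rfl, rfl⟩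
  · exact .inl ⟨a :: p, s, x, y, rfl, rfl⟩
  · exact .inr ⟨a :: p, s, x, rfl, rfl⟩

lemma RStep.isWalk {H : Dgraph X} {a b : X} {l l' : List X} (h : RStep l l')
    (hl : IsWalk H a b l) : IsWalk H a b l' := by
  obtain ⟨h1, h2, h3, h4⟩ := hl
  change l.IsChain H.UAdj at h4
  refine ⟨?_, h.head?_eq ▸ h2, ?_, ?_⟩
  · rcases h with ⟨p, s, x, y, rfl, rfl⟩ | ⟨p, s, x, rfl, rfl⟩ <;> simp
  · rw [← h3]
    rcases h with ⟨p, s, x, y, rfl, rfl⟩ | ⟨p, s, x, rfl, rfl⟩ <;>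
      simp [List.getLast?_append, List.getLast?_cons]
  · change l'.IsChain H.UAdj
    rcases h with ⟨p, s, x, y, rfl, rfl⟩ | ⟨p, s, x, rfl, rfl⟩ <;>
    · simp [List.isChain_append, List.isChain_cons] at h4 ⊢
      grind

lemma isReduced_singleton (x : X) : IsReduced [x] := by
  rintro l' (⟨p, s, x, y, h, -⟩ | ⟨p, s, x, h, -⟩) <;> cases p <;> simp at h

lemma isReduced_cons_cons {x y : X} {l : List X} :
    IsReduced (x :: y :: l) ↔ x ≠ y ∧ (∀ z ∈ l.head?, z ≠ x) ∧ IsReduced (y :: l) := by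
  constructor
  · intro h
    refine ⟨?_, ?_, fun l' hl' => h _ (hl'.cons x)⟩
    · rintro rfl
      exact h (x :: l) (.inr ⟨[], l, x, rfl, rfl⟩)
    · rintro z hz rfl
      cases l with
      | nil => simp at hz
      | cons u l =>
        obtain rfl : u = z := by simpa using hz
        exact h (u :: l) (.inl ⟨[], l, u, y, rfl, rfl⟩)
  · rintro ⟨h1, h2, h3⟩ l' (⟨p, s, a, b, h, -⟩ | ⟨p, s, a, h, -⟩)
    · cases p with
      | nil =>
        simp only [List.nil_append, List.cons_append, List.cons.injEq] at h
        obtain ⟨rfl, rfl, rfl⟩ := h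
        exact h2 x (by simp) rfl
      | cons c p =>
        simp only [List.cons_append, List.cons.injEq] at h
        exact h3 _ (.inl ⟨p, s, a, b, h.2, rfl⟩)
    · cases p with
      | nil =>
        simp only [List.nil_append, List.cons_append, List.cons.injEq] at h
        exact h1 (h.1.trans h.2.1.symm)
      | cons c p =>
        simp only [List.cons_append, List.cons.injEq] at h
        exact h3 _ (.inr ⟨p, s, a, h.2, rfl⟩)

lemma exists_isReduced (l : List X) :
    ∃ l', IsReduced l' ∧ PiEq l l' ∧
      ∀ (H : Dgraph X) (a b : X), IsWalk H a b l → IsWalk H a b l' := by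
  induction hn : l.length using Nat.strong_induction_on generalizing l with
  | _ n ih =>
    by_cases h : IsReduced l
    · exact ⟨l, h, .refl _, fun _ _ _ => id⟩
    · simp only [IsReduced, not_forall, not_not] at h
      obtain ⟨l₁, h₁⟩ := h
      obtain ⟨l₂, h₂, h₃, h₄⟩ := ih _ (hn ▸ h₁.length_lt) l₁ rfl
      exact ⟨l₂, h₂, .trans _ _ _ (.rel _ _ h₁) h₃, fun H a b h => h₄ H a b (h₁.isWalk h)⟩

/-- The word in the free group spelled by a walk. -/
def walkWord : List X → List ((X × X) × Bool)
  | x :: y :: l => ((x, y), true) :: ((y, x), false) :: walkWord (y :: l)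
  | _ => []

lemma walkVal_eq_mk (l : List X) : walkVal l = FreeGroup.mk (walkWord l) := by
  induction l with
  | nil => rfl
  | cons x l ih =>
    cases l with
    | nil => rfl
    | cons y l =>
      rw [walkVal_cons_cons, ih]
      simp [walkWord, edgeVal, FreeGroup.of, FreeGroup.invRev]

lemma IsReduced.walkWord {l : List X} (h : IsReduced l) : FreeGroup.IsReduced (walkWord l) := by
  induction l with
  | nil => exact .nil
  | cons x l ih =>
    cases l with
    | nil => exact .nil
    | cons y l =>
      obtain ⟨h1, h2, h3⟩ := isReduced_cons_cons.1 h
      have := ih h3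
      cases l with
      | nil => simpa [HRecoloring.walkWord, FreeGroup.IsReduced] using fun h => (h1 h).elim
      | cons z l =>
        have h4 : z ≠ x := h2 z (by simp)
        simp only [HRecoloring.walkWord, FreeGroup.isReduced_cons_cons] at this ⊢
        simp only [this, Prod.mk.injEq]
        grind

lemma eq_of_walkWord_eq {l l' : List X} (hh : l.head? = l'.head?)
    (h : walkWord l = walkWord l') : l = l' := by
  induction l generalizing l' with
  | nil => cases l' <;> simp_all
  | cons x l ih =>
    match l', l with
    | [], _ => simp at hh
    | [x'], [] => simpa using hh
    | [x'], y :: l => simp [walkWord] at h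
    | x' :: y' :: l', [] => simp [walkWord] at h
    | x' :: y' :: l', y :: l =>
      simp only [walkWord, List.cons.injEq, Prod.mk.injEq] at h
      rw [ih (l' := y' :: l') (by simp [h.1.1.2]) h.2.2, h.1.1.1]

lemma IsReduced.eq_of_walkVal_eq {l l' : List X} (hl : IsReduced l) (hl' : IsReduced l')
    (hh : l.head? = l'.head?) (h : walkVal l = walkVal l') : l = l' := by
  classical
  rw [walkVal_eq_mk, walkVal_eq_mk] at h
  have := FreeGroup.reduce.sound h
  rw [hl.walkWord.reduce_eq, hl'.walkWord.reduce_eq] at this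
  exact eq_of_walkWord_eq hh this

lemma piEq_iff {l l' : List X} :
    PiEq l l' ↔ l.head? = l'.head? ∧ walkVal l = walkVal l' := by
  have key : ∀ {l l' : List X}, PiEq l l' → l.head? = l'.head? ∧ walkVal l = walkVal l' := by
    intro l l' h
    induction h with
    | rel _ _ h => exact ⟨h.head?_eq, h.walkVal_eq⟩
    | refl => exact ⟨rfl, rfl⟩
    | symm _ _ _ ih => exact ⟨ih.1.symm, ih.2.symm⟩
    | trans _ _ _ _ _ ih ih' => exact ⟨ih.1.trans ih'.1, ih.2.trans ih'.2⟩
  refine ⟨key, fun ⟨h1, h2⟩ => ?_⟩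
  obtain ⟨r, hr, hlr, -⟩ := exists_isReduced l
  obtain ⟨r', hr', hlr', -⟩ := exists_isReduced l'
  obtain rfl : r = r' := hr.eq_of_walkVal_eq hr'
    ((key hlr).1.symm.trans (h1.trans (key hlr').1))
    ((key hlr).2.symm.trans (h2.trans (key hlr').2))
  exact .trans _ _ _ hlr (.symm _ _ hlr')

/-- Appending one vertex to a reduced walk affects only the end of its reduced form. -/
lemma IsReduced.exists_concat {x y : X} {l : List X} (h : IsReduced (x :: y :: l)) (z : X) :
    ∃ l', IsReduced (x :: l') ∧ walkVal (x :: l') = walkVal (x :: y :: l ++ [z]) ∧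
      (∀ u ∈ l'.head?, u = y) ∧ (l ≠ [] → l' ≠ []) := by
  induction l generalizing x y with
  | nil =>
    have hxy : x ≠ y := (isReduced_cons_cons.1 h).1
    by_cases hx : z = x
    · exact ⟨[], isReduced_singleton x, by simp [hx], by simp, by simp⟩
    by_cases hy : z = y
    · exact ⟨[y], h, by simp [hy], by simp, by simp⟩
    · refine ⟨[y, z], ?_, by simp, by simp, by simp⟩
      simp [isReduced_cons_cons, hxy, hx, Ne.symm hy, isReduced_singleton]
  | cons u l ih =>
    obtain ⟨hxy, hux, hyu⟩ := isReduced_cons_cons.1 h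
    obtain ⟨l', h1, h2, h3, -⟩ := ih hyu
    refine ⟨y :: l', isReduced_cons_cons.2 ⟨hxy, fun w hw => ?_, h1⟩, ?_, by simp, by simp⟩
    · rw [h3 w hw]
      exact hux u (by simp)
    · simp only [List.cons_append, walkVal_cons_cons] at h2 ⊢
      rw [h2]

end FreeGroupValue

end HRecoloring

namespace HRecoloring

/-! ### Centralizers in free groups -/

section Centralizer

variable {ι : Type*}

lemma eq_one_of_forall_commute [Nontrivial ι] {z : FreeGroup ι} (hz : ∀ g, z * g = g * z) :
    z = 1 := by
  classical
  by_contra h1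
  have hw : z.toWord ≠ [] := fun h => h1 (FreeGroup.toWord_eq_nil_iff.1 h)
  have hred : FreeGroup.IsReduced z.toWord := FreeGroup.isReduced_toWord
  obtain ⟨k, hk⟩ := exists_ne (z.toWord.head hw).1
  set e : ι × Bool := (k, (z.toWord.getLast hw).2) with he
  have h2 : FreeGroup.IsReduced (z.toWord ++ [e]) := by
    refine List.IsChain.append hred (List.isChain_singleton _) fun x hx y hy => ?_
    rw [List.getLast?_eq_some_getLast hw] at hx
    simp only [Option.mem_def, Option.some.injEq, List.head?_cons] at hx hy
    subst hx hy
    simp [he]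
  have h3 : FreeGroup.IsReduced (e :: z.toWord) := by
    refine List.IsChain.cons hred fun y hy => ?_
    rw [List.head?_eq_some_head hw] at hy
    simp only [Option.mem_def, Option.some.injEq] at hy
    subst hy
    exact fun h => (hk h).elim
  have h4 : z.toWord ++ [e] = e :: z.toWord := by
    rw [← h2.reduce_eq, ← h3.reduce_eq]
    apply FreeGroup.reduce.sound
    have := hz (FreeGroup.mk [e])
    rw [← FreeGroup.mk_toWord (x := z)] at this
    simpa using this
  apply hk
  have h5 : (z.toWord ++ [e]).head (by simp) = e := by simp [h4]
  rw [List.head_append_of_ne_nil hw] at h5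
  rw [h5]

lemma isCyclic_centralizer_singleton {g : FreeGroup ι} (hg : g ≠ 1) :
    IsCyclic (Subgroup.centralizer {g} : Subgroup (FreeGroup ι)) := by
  set C : Subgroup (FreeGroup ι) := Subgroup.centralizer {g} with hC
  let φ : FreeGroup (IsFreeGroup.Generators C) ≃* C := IsFreeGroup.mulEquiv C
  rcases subsingleton_or_nontrivial (IsFreeGroup.Generators C) with h | h
  · have : IsCyclic (FreeGroup (IsFreeGroup.Generators C)) := by
      rcases isEmpty_or_nonempty (IsFreeGroup.Generators C) with h' | h'
      · infer_instance
      · have : Unique (IsFreeGroup.Generators C) := uniqueOfSubsingleton h'.some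
        infer_instance
    exact isCyclic_of_surjective φ φ.surjective
  · have hgC : g ∈ C := by simp [hC, Subgroup.mem_centralizer_iff]
    refine (hg ?_).elim
    have h1 : φ.symm ⟨g, hgC⟩ = 1 := eq_one_of_forall_commute fun x => by
      apply φ.injective
      ext
      have := Subgroup.mem_centralizer_iff.1 (φ x).2 g rfl
      simpa using this
    simpa using congrArg (fun x => (φ x : FreeGroup ι)) h1

lemma exists_zpowers_eq {g : FreeGroup ι} (hg : g ≠ 1) {Z : Subgroup (FreeGroup ι)}
    (hZ : ∀ z ∈ Z, g * z = z * g) : ∃ r, Subgroup.zpowers r = Z := by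
  have := isCyclic_centralizer_singleton hg
  have hle : Z ≤ Subgroup.centralizer {g} := fun z hz =>
    Subgroup.mem_centralizer_iff.2 fun x hx => by
      rw [Set.mem_singleton_iff.1 hx]
      exact hZ z hz
  have := Subgroup.isCyclic_of_le hle
  exact Z.isCyclic_iff_exists_zpowers_eq_top.1 this

end Centralizer

/-! ### Basic facts on walks -/

section Walks

variable {V X : Type} {G : Dgraph V} {H : Dgraph X}

lemma isWalk_singleton_iff {a b x : V} : IsWalk G a b [x] ↔ x = a ∧ x = b := by
  constructor
  · rintro ⟨-, h1, h2, -⟩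
    simpa using And.intro h1 h2
  · rintro ⟨rfl, rfl⟩
    exact ⟨by simp, rfl, rfl, List.isChain_singleton _⟩

lemma isWalk_cons_cons {a b x y : V} {l : List V} :
    IsWalk G a b (x :: y :: l) ↔ x = a ∧ G.UAdj x y ∧ IsWalk G y b (y :: l) := by
  constructor
  · rintro ⟨-, h1, h2, h3⟩
    have h3 := List.isChain_cons_cons.1 h3
    exact ⟨by simpa using h1, h3.1, by simp, rfl, by simpa using h2, h3.2⟩
  · rintro ⟨rfl, h1, -, -, h2, h3⟩
    exact ⟨by simp, rfl, by simpa using h2, List.isChain_cons_cons.2 ⟨h1, h3⟩⟩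

lemma IsWalk.exists_eq_cons {a b : V} {l : List V} (h : IsWalk G a b l) : ∃ m, l = a :: m := by
  obtain ⟨-, h1, -⟩ := h
  cases l with
  | nil => simp at h1
  | cons x m => exact ⟨m, by simpa using h1⟩

lemma IsWalk.wcomp {a b c : V} {l m : List V} (hl : IsWalk G a b l) (hm : IsWalk G b c m) :
    IsWalk G a c (wcomp l m) := by
  obtain ⟨m, rfl⟩ := hm.exists_eq_cons
  induction l generalizing a with
  | nil => exact (hl.1 rfl).elim
  | cons x l ih =>
    cases l with
    | nil =>
      obtain ⟨rfl, rfl⟩ := isWalk_singleton_iff.1 hl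
      exact hm
    | cons y l =>
      obtain ⟨rfl, h1, h2⟩ := isWalk_cons_cons.1 hl
      exact isWalk_cons_cons.2 ⟨rfl, h1, ih h2⟩

lemma IsWalk.reverse {a b : V} {l : List V} (hl : IsWalk G a b l) : IsWalk G b a l.reverse := by
  obtain ⟨h1, h2, h3, h4⟩ := hl
  refine ⟨by simpa using h1, by simpa using h3, by simpa using h2, ?_⟩
  exact List.isChain_reverse.2 (List.IsChain.imp (fun _ _ h => h.symm) h4)

lemma IsWalk.map {a b : V} {l : List V} (hl : IsWalk G a b l) {f : V → X} (hf : IsHom G H f) :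
    IsWalk H (f a) (f b) (l.map f) := by
  obtain ⟨h1, h2, h3, h4⟩ := hl
  refine ⟨by simpa using h1, by simp [h2], by simp [h3], ?_⟩
  exact (List.isChain_map f).2 (List.IsChain.imp (fun _ _ h => h.imp (@hf _ _) (@hf _ _)) h4)

lemma IsWalk.walkVal_map_wcomp {a b c : V} {l m : List V} (hl : IsWalk G a b l)
    (hm : IsWalk G b c m) (f : V → X) :
    walkVal ((HRecoloring.wcomp l m).map f) = walkVal (l.map f) * walkVal (m.map f) := by
  obtain ⟨m, rfl⟩ := hm.exists_eq_cons
  induction l generalizing a with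
  | nil => exact (hl.1 rfl).elim
  | cons x l ih =>
    cases l with
    | nil =>
      obtain ⟨rfl, rfl⟩ := isWalk_singleton_iff.1 hl
      simp [HRecoloring.wcomp]
    | cons y l =>
      obtain ⟨rfl, h1, h2⟩ := isWalk_cons_cons.1 hl
      have := ih h2
      simp only [HRecoloring.wcomp, List.cons_append, List.map_cons, walkVal_cons_cons] at this ⊢
      rw [this, mul_assoc]

lemma IsWalk.walkVal_wcomp {a b c : X} {l m : List X} (hl : IsWalk H a b l)
    (hm : IsWalk H b c m) : walkVal (HRecoloring.wcomp l m) = walkVal l * walkVal m := by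
  simpa using hl.walkVal_map_wcomp hm id

lemma isWalk_witer {a : X} {R : List X} (hR : IsWalk H a a R) (n : ℕ) :
    IsWalk H a a (witer R a n) ∧ walkVal (witer R a n) = walkVal R ^ n := by
  induction n with
  | zero => exact ⟨isWalk_singleton_iff.2 ⟨rfl, rfl⟩, by simp [witer]⟩
  | succ n ih => exact ⟨hR.wcomp ih.1, by rw [witer, hR.walkVal_wcomp ih.1, ih.2, pow_succ']⟩

lemma isWalk_zpowWalk {a : X} {R : List X} (hR : IsWalk H a a R) (n : ℤ) :
    IsWalk H a a (zpowWalk R a n) ∧ walkVal (zpowWalk R a n) = walkVal R ^ n := by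
  unfold zpowWalk
  split_ifs with hn
  · obtain ⟨m, rfl⟩ := Int.eq_ofNat_of_zero_le hn
    simpa using isWalk_witer hR m
  · obtain ⟨m, hm⟩ := Int.eq_ofNat_of_zero_le (show 0 ≤ -n by omega)
    obtain rfl : n = -m := by omega
    simpa [walkVal_reverse] using isWalk_witer hR.reverse m

/-- The values of the closed walks at `a`. -/
def closedWalkSubgroup (H : Dgraph X) (a : X) : Subgroup (FreeGroup (X × X)) where
  carrier := {g | ∃ l, IsWalk H a a l ∧ walkVal l = g}
  mul_mem' := by
    rintro _ _ ⟨l, hl, rfl⟩ ⟨m, hm, rfl⟩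
    exact ⟨_, hl.wcomp hm, hl.walkVal_wcomp hm⟩
  one_mem' := ⟨[a], isWalk_singleton_iff.2 ⟨rfl, rfl⟩, rfl⟩
  inv_mem' := by
    rintro _ ⟨l, hl, rfl⟩
    exact ⟨_, hl.reverse, walkVal_reverse l⟩

lemma IsWalk.piEq_iff {a b c : X} {l m : List X} (hl : IsWalk H a b l) (hm : IsWalk H a c m) :
    PiEq l m ↔ walkVal l = walkVal m := by
  rw [HRecoloring.piEq_iff, hl.2.1, hm.2.1]
  simp

lemma IsWalk.eq_of_isReduced {a b c : X} {l m : List X} (hl : IsWalk H a b l)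
    (hm : IsWalk H a c m) (hl' : IsReduced l) (hm' : IsReduced m) (h : walkVal l = walkVal m) :
    l = m :=
  hl'.eq_of_walkVal_eq hm' (hl.2.1.trans hm.2.1.symm) h

lemma IsWalk.of_piEq {a b : X} {l m : List X} (hl : IsWalk H a b l) (h : PiEq l m)
    (hm : IsReduced m) : IsWalk H a b m := by
  obtain ⟨r, hr, hlr, hw⟩ := exists_isReduced l
  obtain ⟨h1, h2⟩ := HRecoloring.piEq_iff.1 (.trans _ _ _ (.symm _ _ hlr) h)
  exact hr.eq_of_walkVal_eq hm h1 h2 ▸ hw H a b hl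

end Walks

end HRecoloring

namespace HRecoloring

/-! ### Compatible families -/

section Compatible

variable {V X : Type} {G : Dgraph V} {H : Dgraph X} {α β : V → X}

/-- The values `s v` satisfy `α(W) · s v = s u · β(W)` for every edge `W = u v`. -/
def Compatible (G : Dgraph V) (α β : V → X) (s : V → FreeGroup (X × X)) : Prop :=
  ∀ ⦃v w⦄, G.UAdj v w → edgeVal (α v) (α w) * s w = s v * edgeVal (β v) (β w)

lemma Compatible.walk {s : V → FreeGroup (X × X)} (hs : Compatible G α β s) {u v : V}
    {W : List V} (hW : IsWalk G u v W) :
    walkVal (W.map α) * s v = s u * walkVal (W.map β) := by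
  induction W generalizing u with
  | nil => exact (hW.1 rfl).elim
  | cons x W ih =>
    cases W with
    | nil =>
      obtain ⟨rfl, rfl⟩ := isWalk_singleton_iff.1 hW
      simp
    | cons y W =>
      obtain ⟨rfl, h1, h2⟩ := isWalk_cons_cons.1 hW
      have h3 := ih h2
      simp only [List.map_cons, walkVal_cons_cons] at h3 ⊢
      rw [mul_assoc, h3, ← mul_assoc, hs h1, mul_assoc]

/-- A compatible family of reduced walks `S v` from `α v` to `β v`. -/
structure WalkFamily (G : Dgraph V) (H : Dgraph X) (α β : V → X) (S : V → List X) : Prop where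
  isWalk : ∀ v, IsWalk H (α v) (β v) (S v)
  isReduced : ∀ v, IsReduced (S v)
  compatible : Compatible G α β fun v => walkVal (S v)

lemma exists_walkFamily (hG : G.WConn) (hα : IsHom G H α) (hβ : IsHom G H β) {q : V}
    {Q : List X} (hQ : IsWalk H (α q) (β q) Q)
    (hval : ∀ C, IsWalk G q q C →
      walkVal (C.map α) * walkVal Q = walkVal Q * walkVal (C.map β)) :
    ∃ S, WalkFamily G H α β S ∧ walkVal (S q) = walkVal Q := by
  choose W hW using hG q
  choose S hSred hSeq hSwalk using fun v => exists_isReduced (conj α β (W v) Q)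
  have hA : ∀ v, IsWalk H (α v) (α q) ((W v).map α).reverse := fun v => ((hW v).map hα).reverse
  have hval' : ∀ v, walkVal (S v) =
      (walkVal ((W v).map α))⁻¹ * walkVal Q * walkVal ((W v).map β) := fun v => by
    rw [← (piEq_iff.1 (hSeq v)).2, conj, ((hA v).wcomp hQ).walkVal_wcomp ((hW v).map hβ),
      (hA v).walkVal_wcomp hQ, walkVal_reverse]
  refine ⟨S, ⟨fun v => hSwalk v H _ _ (((hA v).wcomp hQ).wcomp ((hW v).map hβ)), hSred,
    fun v w hvw => ?_⟩, ?_⟩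
  · have he : IsWalk G v w [v, w] := isWalk_cons_cons.2 ⟨rfl, hvw, isWalk_singleton_iff.2 ⟨rfl, rfl⟩⟩
    have hval₂ := hval _ (((hW v).wcomp he).wcomp (hW w).reverse)
    have hmap : ∀ f : V → X,
        walkVal ((wcomp (wcomp (W v) [v, w]) (W w).reverse).map f) =
          walkVal ((W v).map f) * edgeVal (f v) (f w) * (walkVal ((W w).map f))⁻¹ := fun f => by
      rw [((hW v).wcomp he).walkVal_map_wcomp (hW w).reverse, (hW v).walkVal_map_wcomp he,
        List.map_reverse, walkVal_reverse]
      simp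
    rw [hmap, hmap] at hval₂
    simp only [hval']
    calc _ = (walkVal ((W v).map α))⁻¹ * (walkVal ((W v).map α) * edgeVal (α v) (α w) *
          (walkVal ((W w).map α))⁻¹ * walkVal Q) * walkVal ((W w).map β) := by group
      _ = _ := by rw [hval₂]; group
  · rw [hval', mul_assoc, ← hval _ (hW q), inv_mul_cancel_left]

/-- A set of vertices in which every vertex has two neighbors in the set whose colors differ from
each other and from its own color. -/
def IsTight (G : Dgraph V) (α : V → X) (T : Set V) : Prop :=
  T.Nonempty ∧ ∀ v ∈ T, ∃ u ∈ T, ∃ w ∈ T,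
    G.UAdj v u ∧ G.UAdj v w ∧ α u ≠ α v ∧ α w ≠ α v ∧ α u ≠ α w

/-- The initial segments of the sequence of vertices `f i, f (i + 1), …`. -/
def segment (f : ℕ → V) : ℕ → ℕ → List V
  | i, 0 => [f i]
  | i, n + 1 => f i :: segment f (i + 1) n

lemma segment_eq_cons (f : ℕ → V) (i n : ℕ) : ∃ l, segment f i n = f i :: l := by
  cases n <;> exact ⟨_, rfl⟩

lemma length_segment (f : ℕ → V) (i n : ℕ) : (segment f i n).length = n + 1 := by
  induction n generalizing i with
  | zero => rfl
  | succ n ih => simp [segment, ih]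

lemma isWalk_segment {f : ℕ → V} (hf : ∀ n, G.UAdj (f n) (f (n + 1))) (i n : ℕ) :
    IsWalk G (f i) (f (i + n)) (segment f i n) := by
  induction n generalizing i with
  | zero => exact isWalk_singleton_iff.2 ⟨rfl, rfl⟩
  | succ n ih =>
    have h := ih (i + 1)
    obtain ⟨l, hl⟩ := segment_eq_cons f (i + 1) n
    rw [segment, hl, isWalk_cons_cons, ← hl]
    exact ⟨rfl, hf i, by rwa [show i + (n + 1) = i + 1 + n by omega]⟩

lemma isReduced_segment {f : ℕ → X} (h1 : ∀ n, f n ≠ f (n + 1)) (h2 : ∀ n, f (n + 2) ≠ f n)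
    (i n : ℕ) : IsReduced (segment f i n) := by
  induction n generalizing i with
  | zero => exact isReduced_singleton _
  | succ n ih =>
    have h := ih (i + 1)
    cases n with
    | zero => simp [segment, isReduced_cons_cons, isReduced_singleton, h1]
    | succ n =>
      obtain ⟨l, hl⟩ := segment_eq_cons f (i + 1 + 1) n
      simp only [segment, hl] at h ⊢
      refine isReduced_cons_cons.2 ⟨h1 i, ?_, h⟩
      simpa using h2 i

lemma map_segment (f : ℕ → V) (g : V → X) (i n : ℕ) :
    (segment f i n).map g = segment (fun k => g (f k)) i n := by
  induction n generalizing i with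
  | zero => rfl
  | succ n ih => simp [segment, ih]

lemma IsTight.exists_closed_walk [Finite V] {T : Set V} (hT : IsTight G α T) :
    ∃ v C, IsWalk G v v C ∧ walkVal (C.map α) ≠ 1 := by
  obtain ⟨⟨v₀, hv₀⟩, hT⟩ := hT
  let A := {p : V × V // p.2 ∈ T ∧ G.UAdj p.1 p.2 ∧ α p.1 ≠ α p.2}
  have step : ∀ p : A, ∃ p' : A, p'.1.1 = p.1.2 ∧ α p'.1.2 ≠ α p.1.1 := by
    rintro ⟨⟨u, v⟩, hv, huv, hne⟩
    obtain ⟨x, hx, y, hy, hvx, hvy, hxv, hyv, hxy⟩ := hT v hv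
    by_cases hu : α x = α u
    · exact ⟨⟨(v, y), hy, hvy, hyv.symm⟩, rfl, fun h => hxy (hu.trans h.symm)⟩
    · exact ⟨⟨(v, x), hx, hvx, hxv.symm⟩, rfl, hu⟩
  choose next hnext1 hnext2 using step
  obtain ⟨x, hx, -, -, hvx, -, hxv, -⟩ := hT v₀ hv₀
  let p₀ : A := ⟨(v₀, x), hx, hvx, hxv.symm⟩
  let f : ℕ → V := fun n => (next^[n] p₀).1.1
  have hsucc : ∀ n, f (n + 1) = (next^[n] p₀).1.2 := fun n => by
    simp only [f, Function.iterate_succ_apply', hnext1]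
  have hadj : ∀ n, G.UAdj (f n) (f (n + 1)) := fun n => by
    rw [hsucc]; exact (next^[n] p₀).2.2.1
  have hne1 : ∀ n, α (f n) ≠ α (f (n + 1)) := fun n => by
    rw [hsucc]; exact (next^[n] p₀).2.2.2
  have hne2 : ∀ n, α (f (n + 2)) ≠ α (f n) := fun n => by
    rw [hsucc (n + 1), Function.iterate_succ_apply']
    exact hnext2 _
  have key : ∀ i j, i < j → f i = f j → ∃ v C, IsWalk G v v C ∧ walkVal (C.map α) ≠ 1 := by
    intro i j hij hf
    obtain ⟨n, rfl⟩ := Nat.exists_eq_add_of_lt hij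
    have hw := isWalk_segment hadj i (n + 1)
    have hf' : f (i + (n + 1)) = f i := hf.symm
    rw [hf'] at hw
    refine ⟨f i, _, hw, fun h => ?_⟩
    have hr := isReduced_segment (f := fun k => α (f k)) hne1 hne2 i (n + 1)
    rw [map_segment] at h
    have := congrArg List.length <| hr.eq_of_walkVal_eq (isReduced_singleton (α (f i)))
      (by simp [segment]) (by simpa using h)
    simp [length_segment] at this
  obtain ⟨i, j, hij, hf⟩ := Finite.exists_ne_map_eq_of_infinite f
  rcases lt_or_gt_of_ne hij with h | h
  · exact key i j h hf
  · exact key j i h hf.symm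

lemma exists_periodicPt {A : Type*} [Finite A] (f : A → A) (a : A) :
    (Function.periodicPts f).Nonempty := by
  obtain ⟨i, j, hij, h⟩ := Finite.exists_ne_map_eq_of_infinite fun n => f^[n] a
  wlog hlt : i < j generalizing i j
  · exact this j i hij.symm h.symm (by omega)
  · refine ⟨f^[i] a, Function.mk_mem_periodicPts (n := j - i) (by omega) ?_⟩
    rw [Function.IsPeriodicPt, Function.IsFixedPt, ← Function.iterate_add_apply,
      Nat.sub_add_cancel hlt.le]
    exact h.symm

lemma WalkFamily.eq_cons_cons {S : V → List X} (hS : WalkFamily G H α β S) (hβ : IsHom G H β)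
    {v w : V} (hvw : G.UAdj v w) {b : X} {l : List X} (hv : S v = α v :: b :: l)
    (h1 : α w ≠ α v) (h2 : α w ≠ b) : ∃ l', S w = α w :: α v :: l' := by
  have hred : IsReduced (α w :: α v :: b :: l) :=
    isReduced_cons_cons.2 ⟨h1, by simpa using h2.symm, hv ▸ hS.isReduced v⟩
  obtain ⟨L, hL1, hL2, hL3, hL4⟩ := hred.exists_concat (β w)
  have he : IsWalk H (β v) (β w) [β v, β w] :=
    IsWalk.map (isWalk_cons_cons.2 ⟨rfl, hvw, isWalk_singleton_iff.2 ⟨rfl, rfl⟩⟩) hβ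
  have hcat := (hS.isWalk v).walkVal_wcomp he
  have hcomp := hS.compatible hvw
  simp only [wcomp, hv, List.tail_cons, walkVal_cons_cons, walkVal_singleton, mul_one,
    List.cons_append] at hcat hcomp hL2
  have hSw : S w = α w :: L := by
    refine (hS.isReduced w).eq_of_walkVal_eq hL1 (hS.isWalk w).2.1 ?_
    rw [hL2, hcat, ← hcomp, edgeVal_mul_swap_mul]
  cases L with
  | nil => exact (hL4 (by simp) rfl).elim
  | cons u L =>
    obtain rfl := hL3 u (by simp)
    exact ⟨L, hSw⟩

/-- If no set is tight, some vertex can make the first step of its walk. -/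
lemma WalkFamily.exists_movable [Finite V] {S : V → List X} (hS : WalkFamily G H α β S)
    (hβ : IsHom G H β) (hT : ∀ T, ¬ IsTight G α T)
    (hne : ∃ v b l, S v = α v :: b :: l) :
    ∃ v b l, S v = α v :: b :: l ∧ ∀ w, G.UAdj v w → α w = α v ∨ α w = b := by
  by_contra! hcon
  let U := {v : V // ∃ b l, S v = α v :: b :: l}
  choose t r htr using fun v : U => v.2
  have step : ∀ v : U, ∃ w : U, G.UAdj v.1 w.1 ∧ α w.1 ≠ α v.1 ∧ α w.1 ≠ t v ∧ t w = α v.1 := by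
    intro v
    obtain ⟨w, hvw, h1, h2⟩ := hcon v.1 _ _ (htr v)
    obtain ⟨l', hl'⟩ := hS.eq_cons_cons hβ hvw (htr v) h1 h2
    refine ⟨⟨w, _, _, hl'⟩, hvw, h1, h2, ?_⟩
    have := (htr ⟨w, _, _, hl'⟩).symm.trans hl'
    simp only [List.cons.injEq] at this
    exact this.2.1
  choose next h1 h2 h3 h4 using step
  obtain ⟨v, b, l, hv⟩ := hne
  refine hT (Subtype.val '' Function.periodicPts next)
    ⟨(exists_periodicPt next ⟨v, b, l, hv⟩).image _, ?_⟩
  rintro _ ⟨x, hx, rfl⟩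
  obtain ⟨u, hu, rfl⟩ := (Function.bijOn_periodicPts next).surjOn hx
  refine ⟨u, ⟨u, hu, rfl⟩, _, ⟨_, (Function.bijOn_periodicPts next).mapsTo hx, rfl⟩,
    (h1 u).symm, h1 _, (h2 u).symm, h2 _, ?_⟩
  have := h3 (next u)
  rw [h4] at this
  exact this.symm

end Compatible

end HRecoloring

namespace HRecoloring

/-! ### Recoloring sequences -/

section Recoloring

variable {V X : Type} {G : Dgraph V} {H : Dgraph X} {α β : V → X}

lemma compatible_colorWalk {σs : List (V → X)} (hα : σs.head? = some α)
    (hβ : σs.getLast? = some β) (h : σs.IsChain fun σ σ' => ∃! u, σ u ≠ σ' u)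
    (hp : PushOrPull G σs) : Compatible G α β fun v => walkVal (colorWalk σs v) := by
  induction σs generalizing α with
  | nil => simp at hα
  | cons σ σs ih =>
    obtain rfl : σ = α := by simpa using hα
    cases σs with
    | nil =>
      obtain rfl : σ = β := by simpa using hβ
      intro v w _
      simp [colorWalk]
    | cons τ σs =>
      obtain ⟨⟨u, hu, huniq⟩, h⟩ := List.isChain_cons_cons.1 h
      obtain ⟨hpu, hp⟩ := List.isChain_cons_cons.1 hp
      have huniq' : ∀ v, v ≠ u → σ v = τ v := fun v hv => by
        by_contra hne
        exact hv (huniq v hne)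
      intro v w hvw
      have := ih rfl (by simpa using hβ) h hp hvw
      simp only [colorWalk, List.map_cons, walkVal_cons_cons] at this ⊢
      rw [mul_assoc, ← this]
      by_cases hv : v = u
      · subst hv
        by_cases hw : w = v
        · subst hw; simp
        · rw [← huniq' w hw]
          rcases hpu v hu w hvw with h | h <;> simp [h]
      · by_cases hw : w = u
        · subst hw
          rw [← huniq' v hv]
          rcases hpu w hu v hvw.symm with h | h <;> simp [h]
        · simp [huniq' v hv, huniq' w hw]

/-- The vertices of a tight set are never recolored. -/
lemma IsTight.walkVal_colorWalk {T : Set V} (hT : IsTight G α T) {σs : List (V → X)}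
    (hα : σs.head? = some α) (hp : PushOrPull G σs) {v : V} (hv : v ∈ T) :
    walkVal (colorWalk σs v) = 1 := by
  induction σs generalizing α with
  | nil => simp at hα
  | cons σ σs ih =>
    obtain rfl : σ = α := by simpa using hα
    cases σs with
    | nil => rfl
    | cons τ σs =>
      obtain ⟨hpu, hp⟩ := List.isChain_cons_cons.1 hp
      have hfix : ∀ v ∈ T, τ v = σ v := by
        intro v hv
        by_contra hne
        obtain ⟨u, -, w, -, hvu, hvw, h1, h2, h3⟩ := hT.2 v hv
        have hu := (hpu v (Ne.symm hne) u hvu).resolve_left h1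
        have hw := (hpu v (Ne.symm hne) w hvw).resolve_left h2
        exact h3 (hu.trans hw.symm)
      have hT' : IsTight G τ T := by
        refine ⟨hT.1, fun v hv => ?_⟩
        obtain ⟨u, hu, w, hw, h⟩ := hT.2 v hv
        exact ⟨u, hu, w, hw, by rwa [hfix u hu, hfix v hv, hfix w hw]⟩
      have := ih hT' rfl hp
      simp only [colorWalk, List.map_cons, walkVal_cons_cons] at this ⊢
      rw [this, hfix v hv, edgeVal_self, one_mul]

section Update

variable [DecidableEq V] {v : V} {b : X}

lemma isHom_update (hH : H.IsReflexive) (hHsym : H.IsSymmetric) (hα : IsHom G H α)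
    (hadj : H.Adj (α v) b) (hv : ∀ w, G.UAdj v w → α w = α v ∨ α w = b) :
    IsHom G H (Function.update α v b) := by
  intro x y hxy
  by_cases hx : x = v <;> by_cases hy : y = v
  · simp [hx, hy, hH b]
  · subst hx
    rw [Function.update_self, Function.update_of_ne hy]
    rcases hv y (.inl hxy) with h | h <;> rw [h]
    exacts [hHsym _ _ hadj, hH b]
  · subst hy
    rw [Function.update_self, Function.update_of_ne hx]
    rcases hv x (.inr hxy) with h | h <;> rw [h]
    exacts [hadj, hH b]
  · rw [Function.update_of_ne hx, Function.update_of_ne hy]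
    exact hα hxy

lemma IsTight.of_update {T : Set V} (hT : IsTight G (Function.update α v b) T)
    (hv : ∀ w, G.UAdj v w → α w = α v ∨ α w = b) : IsTight G α T := by
  have hvT : v ∉ T := by
    intro hvT
    obtain ⟨u, -, w, -, hvu, hvw, h1, h2, h3⟩ := hT.2 v hvT
    have hu : u ≠ v := by rintro rfl; exact h1 rfl
    have hw : w ≠ v := by rintro rfl; exact h2 rfl
    rw [Function.update_self, Function.update_of_ne hu] at h1
    rw [Function.update_self, Function.update_of_ne hw] at h2
    rw [Function.update_of_ne hu, Function.update_of_ne hw] at h3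
    exact h3 (((hv u hvu).resolve_right h1).trans ((hv w hvw).resolve_right h2).symm)
  have hfix : ∀ u ∈ T, Function.update α v b u = α u := fun u hu =>
    Function.update_of_ne (by rintro rfl; exact hvT hu) _ _
  refine ⟨hT.1, fun x hx => ?_⟩
  obtain ⟨u, hu, w, hw, h⟩ := hT.2 x hx
  exact ⟨u, hu, w, hw, by rwa [hfix u hu, hfix x hx, hfix w hw] at h⟩

lemma WalkFamily.update {S : V → List X} (hS : WalkFamily G H α β S) {l : List X}
    (hSv : S v = α v :: b :: l) (hv : ∀ w, G.UAdj v w → α w = α v ∨ α w = b) :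
    WalkFamily G H (Function.update α v b) β (Function.update S v (b :: l)) where
  isWalk w := by
    have h := hS.isWalk w
    by_cases hw : w = v
    · subst hw
      rw [hSv, isWalk_cons_cons] at h
      simpa using h.2.2
    · simpa [hw] using h
  isReduced w := by
    have h := hS.isReduced w
    by_cases hw : w = v
    · subst hw
      rw [hSv, isReduced_cons_cons] at h
      simpa using h.2.2
    · simpa [hw] using h
  compatible := by
    intro x y hxy
    have h := hS.compatible hxy
    by_cases hx : x = v <;> by_cases hy : y = v
    · simp [hx, hy]
    · subst hx
      simp only [hSv, walkVal_cons_cons] at h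
      simp only [Function.update_self, Function.update_of_ne hy]
      rcases hv y hxy with h' | h'
      · rw [h', edgeVal_self, one_mul] at h
        rw [h', h, mul_assoc, edgeVal_mul_swap_mul]
      · rw [h', mul_assoc] at h
        rw [h', edgeVal_self, one_mul, mul_left_cancel h]
    · subst hy
      simp only [hSv, walkVal_cons_cons] at h
      simp only [Function.update_self, Function.update_of_ne hx]
      rcases hv x hxy.symm with h' | h'
      · rwa [h', edgeVal_self, one_mul, ← h'] at h
      · rw [h', edgeVal_mul_swap_mul] at h
        rw [h', edgeVal_self, one_mul, h]
    · simpa [hx, hy] using h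

end Update

lemma WalkFamily.exists_recoloring [Fintype V] (hH : H.IsReflexive) (hHsym : H.IsSymmetric)
    (hβ : IsHom G H β) {α : V → X} (hα : IsHom G H α) {S : V → List X}
    (hS : WalkFamily G H α β S) (hT : ∀ T, ¬ IsTight G α T) :
    ∃ σs : List (V → X), AdjRecolSeq G H σs ∧ σs.head? = some α ∧ σs.getLast? = some β ∧
      PushOrPull G σs ∧ ∀ v, walkVal (colorWalk σs v) = walkVal (S v) := by
  classical
  induction hn : ∑ v, (S v).length using Nat.strong_induction_on generalizing α S with
  | _ n ih =>
    by_cases hne : ∃ v b l, S v = α v :: b :: l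
    · obtain ⟨v, b, l, hSv, hv⟩ := hS.exists_movable hβ hT hne
      have hαb : α v ≠ b := (isReduced_cons_cons.1 (hSv ▸ hS.isReduced v)).1
      have hadj : H.Adj (α v) b :=
        (isWalk_cons_cons.1 (hSv ▸ hS.isWalk v)).2.1.elim id (hHsym _ _)
      have hlt : ∑ w, (Function.update S v (b :: l) w).length < n := by
        rw [← hn]
        refine Finset.sum_lt_sum (fun w _ => ?_) ⟨v, Finset.mem_univ v, by simp [hSv]⟩
        by_cases hw : w = v
        · subst hw; simp [hSv]
        · simp [hw]
      obtain ⟨σs, ⟨-, h2, h3⟩, h4, h5, h6, h7⟩ := ih _ hlt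
        (isHom_update hH hHsym hα hadj hv) (hS.update hSv hv) (fun T h => hT T (h.of_update hv)) rfl
      have hmove : ∀ u, α u ≠ Function.update α v b u → u = v := fun u hu => by
        by_contra hne
        exact hu (Function.update_of_ne hne _ _).symm
      cases σs with
      | nil => simp at h4
      | cons σ σs =>
        obtain rfl : σ = Function.update α v b := by simpa using h4
        refine ⟨α :: Function.update α v b :: σs, ⟨by simp, ?_, ?_⟩, rfl, by simpa using h5, ?_, ?_⟩
        · rintro σ (_ | ⟨_, hσ⟩)
          exacts [hα, h2 σ hσ]
        · refine List.isChain_cons_cons.2 ⟨⟨⟨v, by simpa using hαb, hmove⟩, fun u hu => ?_⟩, h3⟩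
          obtain rfl := hmove u hu
          simpa using hadj
        · refine List.isChain_cons_cons.2 ⟨fun u hu w huw => ?_, h6⟩
          obtain rfl := hmove u hu
          simpa using hv w huw
        · intro u
          have := h7 u
          simp only [colorWalk, List.map_cons, walkVal_cons_cons] at this ⊢
          rw [this]
          by_cases hu : u = v
          · subst hu; simp [hSv]
          · simp [hu]
    · have hsing : ∀ v, S v = [α v] := fun v => by
        obtain ⟨m, hm⟩ := (hS.isWalk v).exists_eq_cons
        cases m with
        | nil => exact hm
        | cons b l => exact (hne ⟨v, b, l, hm⟩).elim
      obtain rfl : α = β := funext fun v =>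
        (isWalk_singleton_iff.1 (hsing v ▸ hS.isWalk v)).2
      refine ⟨[α], ⟨by simp, by simpa using hα, List.isChain_singleton _⟩, rfl, rfl,
        List.isChain_singleton _, fun v => ?_⟩
      simp [colorWalk, hsing v]

lemma PRealizable.exists_compatible {q : V} {Q : List X} (h : PRealizable G H α β q Q) :
    ∃ s, Compatible G α β s ∧ s q = walkVal Q ∧ ∀ T, IsTight G α T → ∀ v ∈ T, s v = 1 := by
  obtain ⟨σs, ⟨-, -, h1⟩, h2, h3, h4, h5⟩ := h
  refine ⟨_, compatible_colorWalk h2 h3 (List.IsChain.imp (fun _ _ h => h.1) h1) h4,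
    (piEq_iff.1 h5).2, fun T hT v hv => hT.walkVal_colorWalk h2 h4 hv⟩

/-- Without tight sets, realizability is the same as topological validity. -/
lemma mem_pRealSet_iff [Fintype V] (hH : H.IsReflexive) (hHsym : H.IsSymmetric) (hG : G.WConn)
    (hα : IsHom G H α) (hβ : IsHom G H β) (hT : ∀ T, ¬ IsTight G α T) {q : V} {Q : List X} :
    Q ∈ PRealSet G H α β q ↔ IsWalk H (α q) (β q) Q ∧ IsReduced Q ∧ ∀ C, IsWalk G q q C →
      walkVal (C.map α) * walkVal Q = walkVal Q * walkVal (C.map β) := by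
  refine and_congr_right fun hQ => and_congr_right fun _ => ⟨fun h C hC => ?_, fun h => ?_⟩
  · obtain ⟨s, hs, hsq, -⟩ := h.exists_compatible
    simpa [hsq] using hs.walk hC
  · obtain ⟨S, hS, hSq⟩ := exists_walkFamily hG hα hβ hQ h
    obtain ⟨σs, h1, h2, h3, h4, h5⟩ := hS.exists_recoloring hH hHsym hβ hα hT
    refine ⟨σs, h1, h2, h3, h4, piEq_iff.2 ⟨?_, (h5 q).trans hSq⟩⟩
    rw [colorWalk, List.head?_map, h2, hQ.2.1, Option.map_some]

lemma IsTight.subsingleton_pRealSet {T : Set V} (hT : IsTight G α T) (hG : G.WConn) (q : V) :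
    (PRealSet G H α β q).Subsingleton := by
  rintro Q ⟨hQ, hQr, hQs⟩ Q' ⟨hQ', hQr', hQs'⟩
  obtain ⟨v, hv⟩ := hT.1
  obtain ⟨W, hW⟩ := hG v q
  have key : ∀ R : List X, PRealizable G H α β q R →
      walkVal (W.map α) * walkVal R = walkVal (W.map β) := fun R hR => by
    obtain ⟨s, hs, hsq, hsT⟩ := hR.exists_compatible
    simpa [hsq, hsT T hT v hv] using hs.walk hW
  exact hQ.eq_of_isReduced hQ' hQr hQr' (mul_left_cancel ((key Q hQs).trans (key Q' hQs').symm))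

lemma setOf_subset_pRealSet [Fintype V] (hH : H.IsReflexive) (hHsym : H.IsSymmetric)
    (hG : G.WConn) (hα : IsHom G H α) (hβ : IsHom G H β) (hT : ∀ T, ¬ IsTight G α T) {q : V}
    (h : ∀ C, IsWalk G q q C → walkVal (C.map α) = 1 ∧ walkVal (C.map β) = 1) :
    {Q | IsWalk H (α q) (β q) Q ∧ IsReduced Q} ⊆ PRealSet G H α β q := by
  rintro Q ⟨hQ, hQr⟩
  refine (mem_pRealSet_iff hH hHsym hG hα hβ hT).2 ⟨hQ, hQr, fun C hC => ?_⟩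
  rw [(h C hC).1, (h C hC).2, one_mul, mul_one]

/-- Without tight sets, if some closed walk at `q` has a nontrivial image and `P` is realizable,
then the realizable walks are those of the form `Rⁿ P`. -/
lemma exists_pRealSet_eq_zpow [Fintype V] (hH : H.IsReflexive) (hHsym : H.IsSymmetric)
    (hG : G.WConn) (hα : IsHom G H α) (hβ : IsHom G H β) (hT : ∀ T, ¬ IsTight G α T) {q : V}
    {P : List X} (hP : P ∈ PRealSet G H α β q) {C₀ : List V} (hC₀ : IsWalk G q q C₀)
    (hne : walkVal (C₀.map α) ≠ 1) :
    ∃ R, IsWalk H (α q) (α q) R ∧ PRealSet G H α β q =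
      {Q | IsReduced Q ∧ ∃ n : ℤ, PiEq (wcomp (zpowWalk R (α q) n) P) Q} := by
  have hmem := @mem_pRealSet_iff V X G H α β _ hH hHsym hG hα hβ hT q
  obtain ⟨hPw, -, hPC⟩ := hmem.1 hP
  let Z : Subgroup (FreeGroup (X × X)) :=
    Subgroup.centralizer {g | ∃ C, IsWalk G q q C ∧ walkVal (C.map α) = g} ⊓
      closedWalkSubgroup H (α q)
  obtain ⟨r, hr⟩ := exists_zpowers_eq (Z := Z) hne
    fun z hz => Subgroup.mem_centralizer_iff.1 hz.1 _ ⟨C₀, hC₀, rfl⟩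
  obtain ⟨R, hR, hRr⟩ : r ∈ closedWalkSubgroup H (α q) :=
    (hr ▸ Subgroup.mem_zpowers r : r ∈ Z).2
  have hpow : ∀ n : ℤ, IsWalk H (α q) (β q) (wcomp (zpowWalk R (α q) n) P) ∧
      walkVal (wcomp (zpowWalk R (α q) n) P) = r ^ n * walkVal P := fun n => by
    obtain ⟨h1, h2⟩ := isWalk_zpowWalk hR n
    exact ⟨h1.wcomp hPw, by rw [h1.walkVal_wcomp hPw, h2, hRr]⟩
  refine ⟨R, hR, Set.ext fun Q => hmem.trans ⟨fun ⟨hQ, hQr, hQC⟩ => ⟨hQr, ?_⟩, ?_⟩⟩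
  · have hz : walkVal Q * (walkVal P)⁻¹ ∈ Z := by
      refine ⟨Subgroup.mem_centralizer_iff.2 ?_, _, hQ.wcomp hPw.reverse, ?_⟩
      · rintro _ ⟨C, hC, rfl⟩
        rw [← mul_assoc, hQC C hC, mul_assoc, mul_assoc]
        congr 1
        rw [mul_inv_eq_iff_eq_mul, mul_assoc, hPC C hC, inv_mul_cancel_left]
      · rw [hQ.walkVal_wcomp hPw.reverse, walkVal_reverse]
    rw [← hr] at hz
    obtain ⟨n, hn⟩ := Subgroup.mem_zpowers_iff.1 hz
    refine ⟨n, ((hpow n).1.piEq_iff hQ).2 ?_⟩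
    rw [(hpow n).2, hn, inv_mul_cancel_right]
  · rintro ⟨hQr, n, hn⟩
    refine ⟨(hpow n).1.of_piEq hn hQr, hQr, fun C hC => ?_⟩
    have hz : r ^ n ∈ Z := hr ▸ Subgroup.zpow_mem_zpowers r n
    have := Subgroup.mem_centralizer_iff.1 hz.1 _ ⟨C, hC, rfl⟩
    rw [← (piEq_iff.1 hn).2, (hpow n).2, ← mul_assoc, this, mul_assoc, hPC C hC, mul_assoc]

end Recoloring

end HRecoloring

/-- Classification of realizable walks for reflexive undirected graphs: the
set `\bar Π` of `H`-realizable walks for `α, β, q` is empty, a single walk, of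
the form `{RⁿP : n ∈ ℤ}`, or contains all reduced walks from `α q` to `β q`;
moreover the last case holds whenever `α(C) = β(C) = ε` in `π(H)` for every
closed walk `C` in `G`. -/
theorem statement16 {V X : Type} [Fintype V] [Fintype X]
    (G : Dgraph V) (H : Dgraph X)
    (hGrefl : G.IsReflexive) (hGsym : G.IsSymmetric)
    (hHrefl : H.IsReflexive) (hHsym : H.IsSymmetric)
    (hGconn : G.WConn) (hHconn : H.WConn)
    (α β : V → X) (hα : IsHom G H α) (hβ : IsHom G H β) (q : V) :
    (PRealSet G H α β q = ∅ ∨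
     (∃ Q : List X, PRealSet G H α β q = {Q}) ∨
     (∃ R P : List X, IsWalk H (α q) (α q) R ∧ IsWalk H (α q) (β q) P ∧
       PRealSet G H α β q =
         {Q | IsReduced Q ∧ ∃ n : ℤ, PiEq (wcomp (zpowWalk R (α q) n) P) Q}) ∨
     {Q | IsWalk H (α q) (β q) Q ∧ IsReduced Q} ⊆ PRealSet G H α β q) ∧
    ((∀ (v₀ : V) (C : List V), IsWalk G v₀ v₀ C →
        PiEq (C.map α) [α v₀] ∧ PiEq (C.map β) [β v₀]) →
      {Q | IsWalk H (α q) (β q) Q ∧ IsReduced Q} ⊆ PRealSet G H α β q) := by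
  constructor
  · rcases Set.eq_empty_or_nonempty (PRealSet G H α β q) with h | ⟨P, hP⟩
    · exact .inl h
    by_cases hT : ∃ T, IsTight G α T
    · obtain ⟨T, hT⟩ := hT
      exact .inr (.inl ⟨P, (hT.subsingleton_pRealSet hGconn q).eq_singleton_of_mem hP⟩)
    rw [not_exists] at hT
    by_cases hC : ∃ C, IsWalk G q q C ∧ walkVal (C.map α) ≠ 1
    · obtain ⟨C, hC, hne⟩ := hC
      obtain ⟨R, hR, h⟩ := exists_pRealSet_eq_zpow hHrefl hHsym hGconn hα hβ hT hP hC hne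
      exact .inr (.inr (.inl ⟨R, P, hR, hP.1, h⟩))
    · push Not at hC
      refine .inr (.inr (.inr (setOf_subset_pRealSet hHrefl hHsym hGconn hα hβ hT
        fun C hC' => ⟨hC C hC', ?_⟩)))
      simpa [hC C hC'] using ((mem_pRealSet_iff hHrefl hHsym hGconn hα hβ hT).1 hP).2.2 C hC'
  · intro h
    have h' : ∀ v C, IsWalk G v v C → walkVal (C.map α) = 1 ∧ walkVal (C.map β) = 1 :=
      fun v C hC => ⟨(piEq_iff.1 (h v C hC).1).2, (piEq_iff.1 (h v C hC).2).2⟩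
    refine setOf_subset_pRealSet hHrefl hHsym hGconn hα hβ (fun T hT => ?_) (h' q)
    obtain ⟨v, C, hC, hne⟩ := hT.exists_closed_walk
    exact hne (h' v C hC).1
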